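/- arXiv:2411.12840 — 2 statements merged into one kernel-verified Lean document; each statement's English description precedes it below -/
import Mathlib

section
/- Shift covariance (conditional independence form): let X, Y be standard Borel spaces and let q be an exchangeable probability measure on ℕ → (X × Y). Write the k-th coordinate as (x_k, y_k). Then for every n ∈ ℕ, under q the σ-algebra generated by the coordinates (y_k)_{k ≥ n} and the σ-algebra generated by the coordinates (x_i)_{i < n} are conditionally independent given the σ-algebra generated by the coordinates (x_k)_{k ≥ n}. -/
open MeasureTheory ProbabilityTheory

/-- A measure on `ℕ → Z` is exchangeable if it is invariant under every permutation of `ℕ`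
fixing all but finitely many elements. -/
def Exchangeable {Z : Type*} [MeasurableSpace Z] (p : Measure (ℕ → Z)) : Prop :=
  ∀ σ : Equiv.Perm ℕ, {n | σ n ≠ n}.Finite → p.map (fun x => x ∘ σ) = p

section

variable {X Y : Type*} [MeasurableSpace X] [MeasurableSpace Y]

/-- The σ-algebra on `ℕ → X × Y` generated by the first components of the coordinates
`n + k`, `k ∈ ℕ` (the `X`-tail). -/
def xTail (X Y : Type*) [MeasurableSpace X] [MeasurableSpace Y] (n : ℕ) :
    MeasurableSpace (ℕ → X × Y) :=
  ⨆ k : ℕ, MeasurableSpace.comap (fun x => (x (n + k)).1) inferInstance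

/-- The σ-algebra on `ℕ → X × Y` generated by the second components of the coordinates
`n + k`, `k ∈ ℕ` (the `Y`-tail). -/
def yTail (X Y : Type*) [MeasurableSpace X] [MeasurableSpace Y] (n : ℕ) :
    MeasurableSpace (ℕ → X × Y) :=
  ⨆ k : ℕ, MeasurableSpace.comap (fun x => (x (n + k)).2) inferInstance

/-- The σ-algebra on `ℕ → X × Y` generated by the first components of the coordinates
`i < n` (the `X`-head). -/
def xHead (X Y : Type*) [MeasurableSpace X] [MeasurableSpace Y] (n : ℕ) :
    MeasurableSpace (ℕ → X × Y) :=
  ⨆ i : Fin n, MeasurableSpace.comap (fun x => (x i).1) inferInstance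

lemma xTail_le (n : ℕ) : xTail X Y n ≤ MeasurableSpace.pi :=
  iSup_le fun k => (measurable_fst.comp (measurable_pi_apply (n + k))).comap_le

end

/-- Every injection of `ℕ` agrees on a given finite set with a permutation moving only finitely
many elements. -/
lemma exists_finite_support_perm_eqOn {α : Type*} {φ : α → α} (hφ : Function.Injective φ)
    (I : Finset α) : ∃ σ : Equiv.Perm α, {a | σ a ≠ a}.Finite ∧ ∀ i ∈ I, σ i = φ i := by
  classical
  let J : Finset α := I ∪ I.image φ
  let f : I → J := fun i => ⟨i, Finset.mem_union_left _ i.2⟩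
  let g : I → J := fun i => ⟨φ i, Finset.mem_union_right _ (Finset.mem_image_of_mem φ i.2)⟩
  have hf : Function.Injective f := fun a b h => Subtype.ext (congrArg (fun j : J => (j : α)) h)
  have hg : Function.Injective g := fun a b h =>
    Subtype.ext (hφ (congrArg (fun j : J => (j : α)) h))
  obtain ⟨τ, hτ⟩ := Equiv.Perm.exists_extending_pair f g hf hg
  refine ⟨Equiv.Perm.ofSubtype τ, J.finite_toSet.subset fun a ha => ?_, fun i hi => ?_⟩
  · by_contra h
    exact ha (Equiv.Perm.ofSubtype_apply_of_not_mem τ h)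
  · have h : τ (f ⟨i, hi⟩) = g ⟨i, hi⟩ := hτ ⟨i, hi⟩
    rw [Equiv.Perm.ofSubtype_apply_of_mem τ (Finset.mem_union_left _ hi)]
    exact congrArg Subtype.val h

/-- An exchangeable probability measure is invariant under every injective reindexing. -/
lemma Exchangeable.measurePreserving_comp {Z : Type*} [MeasurableSpace Z] {p : Measure (ℕ → Z)}
    [IsProbabilityMeasure p] (hp : Exchangeable p) {φ : ℕ → ℕ} (hφ : Function.Injective φ) :
    MeasurePreserving (fun x : ℕ → Z => x ∘ φ) p p := by
  have hmeas (ψ : ℕ → ℕ) : Measurable fun x : ℕ → Z => x ∘ ψ :=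
    measurable_pi_lambda _ fun k => measurable_pi_apply (ψ k)
  refine ⟨hmeas φ, IsProjectiveLimit.unique (P := fun I => p.map I.restrict) (fun I => ?_)
    fun I => rfl⟩
  obtain ⟨σ, hσ, hσφ⟩ := exists_finite_support_perm_eqOn hφ I
  have hI : Measurable (I.restrict (π := fun _ : ℕ => Z)) := Finset.measurable_restrict I
  have hcomp : I.restrict ∘ (fun x : ℕ → Z => x ∘ φ) = I.restrict ∘ fun x : ℕ → Z => x ∘ σ := by
    ext x i
    simp [hσφ i i.2]
  calc (p.map fun x => x ∘ φ).map I.restrict = (p.map fun x => x ∘ σ).map I.restrict := by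
        rw [Measure.map_map hI (hmeas φ), Measure.map_map hI (hmeas σ), hcomp]
    _ = p.map I.restrict := by rw [hp σ hσ]

section

variable {Ω : Type*} {m m₀ : MeasurableSpace Ω} {μ : Measure Ω} [IsFiniteMeasure μ]

/-- Conditional expectation commutes with composition by a measure preserving map. -/
lemma condExp_comp_measurePreserving {T : Ω → Ω} (hT : MeasurePreserving T μ μ) (hm : m ≤ m₀)
    {f : Ω → ℝ} (hf : Integrable f μ) :
    μ[f | m] ∘ T =ᵐ[μ] μ[f ∘ T | m.comap T] := by
  have hle : m.comap T ≤ m₀ := (MeasurableSpace.comap_mono hm).trans hT.measurable.comap_le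
  have hint {g : Ω → ℝ} (hg : Integrable g μ) : Integrable (g ∘ T) μ :=
    hT.integrable_comp_of_integrable hg
  have hset {g : Ω → ℝ} (hg : Integrable g μ) {s : Set Ω} (hs : MeasurableSet[m] s) :
      ∫ x in T ⁻¹' s, (g ∘ T) x ∂μ = ∫ x in s, g x ∂μ := by
    have h := setIntegral_map (μ := μ) (g := T) (f := g) (hm s hs)
      (by rw [hT.map_eq]; exact hg.aestronglyMeasurable) hT.measurable.aemeasurable
    rw [hT.map_eq] at h
    exact h.symm
  refine ae_eq_condExp_of_forall_setIntegral_eq hle (hint hf)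
    (fun _ _ _ => (hint integrable_condExp).integrableOn) ?_ ?_
  · rintro _ ⟨s, hs, rfl⟩ -
    rw [hset integrable_condExp hs, hset hf hs, setIntegral_condExp hm hf hs]
  · exact (stronglyMeasurable_condExp.comp_measurable
      (comap_measurable T)).aestronglyMeasurable

/-- If a measure preserving map `T` leaves the square integrable function `f` invariant and pulls
the σ-algebra `m` back into itself, then conditioning `f` on `m` and on its pullback give the same
result. -/
lemma condExp_comap_ae_eq {T : Ω → Ω} (hT : MeasurePreserving T μ μ) (hm : m ≤ m₀)
    (hmT : m.comap T ≤ m) {f : Ω → ℝ} (hf : MemLp f 2 μ) (hfT : f ∘ T = f) :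
    μ[f | m] =ᵐ[μ] μ[f | m.comap T] := by
  have hfi : Integrable f μ := hf.integrable (by norm_num)
  set g := μ[f | m]
  set h := μ[f | m.comap T]
  have hg : MemLp g 2 μ := hf.condExp (by norm_num)
  have hh : MemLp h 2 μ := hf.condExp (by norm_num)
  have hgh : g ∘ T =ᵐ[μ] h := by
    simpa only [hfT] using condExp_comp_measurePreserving hT hm hfi
  have htower : μ[g | m.comap T] =ᵐ[μ] h := condExp_condExp_of_le hmT hm
  have hhg : Integrable (h * g) μ := hh.integrable_mul hg
  have hcross : ∫ x, h x * g x ∂μ = ∫ x, h x ^ 2 ∂μ := by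
    calc ∫ x, h x * g x ∂μ = ∫ x, μ[h * g | m.comap T] x ∂μ :=
          (integral_condExp (hmT.trans hm)).symm
      _ = ∫ x, h x ^ 2 ∂μ := by
          refine integral_congr_ae ?_
          filter_upwards [condExp_mul_of_stronglyMeasurable_left stronglyMeasurable_condExp hhg
            (hg.integrable (by norm_num)), htower] with x hx hx'
          rw [hx, Pi.mul_apply, hx', sq]
  have hsq : ∫ x, g x ^ 2 ∂μ = ∫ x, h x ^ 2 ∂μ := by
    have h1 : ∫ x, g x ^ 2 ∂μ = ∫ x, g (T x) ^ 2 ∂μ := by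
      have h2 := integral_map (μ := μ) (φ := T) hT.measurable.aemeasurable
        (f := fun x => g x ^ 2)
        (by rw [hT.map_eq]; exact hg.integrable_sq.aestronglyMeasurable)
      rwa [hT.map_eq] at h2
    rw [h1]
    refine integral_congr_ae ?_
    filter_upwards [hgh] with x hx
    rw [← hx, Function.comp_apply]
  have hzero : ∫ x, (g x - h x) ^ 2 ∂μ = 0 := by
    have hexp : ∀ x, (g x - h x) ^ 2 = g x ^ 2 + h x ^ 2 - 2 * (h x * g x) := fun x => by ring
    have hhg2 : Integrable (fun x => 2 * (h x * g x)) μ := hhg.const_mul 2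
    have hadd : Integrable (fun x => g x ^ 2 + h x ^ 2) μ :=
      hg.integrable_sq.add hh.integrable_sq
    simp_rw [hexp]
    rw [integral_sub hadd hhg2, integral_add hg.integrable_sq hh.integrable_sq,
      integral_const_mul, hcross, hsq]
    ring
  have hae := (integral_eq_zero_iff_of_nonneg (fun x => sq_nonneg (g x - h x))
    (hg.sub hh).integrable_sq).1 hzero
  filter_upwards [hae] with x hx
  exact sub_eq_zero.1 (pow_eq_zero_iff two_ne_zero |>.1 hx)

/-- If enlarging the conditioning σ-algebra `m'` to some `m` that contains `m₂` does not change the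
conditional probabilities of the events of `m₁`, then `m₁` and `m₂` are conditionally independent
given `m'`. -/
lemma condIndep_of_condExp_ae_eq [StandardBorelSpace Ω] {m' m₁ m₂ : MeasurableSpace Ω}
    (hm' : m' ≤ m₀) (hm'm : m' ≤ m) (hm₂m : m₂ ≤ m) (hm : m ≤ m₀) (hm₁ : m₁ ≤ m₀)
    (h : ∀ s, MeasurableSet[m₁] s → μ⟦s | m⟧ =ᵐ[μ] μ⟦s | m'⟧) :
    CondIndep m' m₁ m₂ hm' μ := by
  rw [condIndep_iff m' m₁ m₂ hm' hm₁ (hm₂m.trans hm)]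
  intro s t hs ht
  have hint {u : Set Ω} (hu : MeasurableSet[m₀] u) :
      Integrable (u.indicator fun _ => (1 : ℝ)) μ := (integrable_const 1).indicator hu
  have hs₀ := hm₁ s hs
  have ht₀ := (hm₂m.trans hm) t ht
  have hmul : (s ∩ t).indicator (fun _ => (1 : ℝ))
      = s.indicator (fun _ => (1 : ℝ)) * t.indicator fun _ => (1 : ℝ) := by
    ext x
    by_cases hxs : x ∈ s <;> by_cases hxt : x ∈ t <;> simp [hxs, hxt]
  have hint' : Integrable (μ⟦s | m'⟧ * t.indicator fun _ => (1 : ℝ)) μ := by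
    have : μ⟦s | m'⟧ * t.indicator (fun _ => (1 : ℝ)) = t.indicator (μ⟦s | m'⟧) := by
      ext x
      by_cases hx : x ∈ t <;> simp [hx]
    rw [this]
    exact integrable_condExp.indicator ht₀
  have h1 : μ⟦s ∩ t | m⟧ =ᵐ[μ] μ⟦s | m'⟧ * t.indicator fun _ => (1 : ℝ) := by
    rw [hmul]
    refine (condExp_mul_of_stronglyMeasurable_right
      (stronglyMeasurable_const.indicator (hm₂m t ht)) (hmul ▸ hint (hs₀.inter ht₀))
      (hint hs₀)).trans ?_
    filter_upwards [h s hs] with x hx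
    rw [Pi.mul_apply, Pi.mul_apply, hx]
  calc μ⟦s ∩ t | m'⟧ =ᵐ[μ] μ[μ⟦s ∩ t | m⟧ | m'] := (condExp_condExp_of_le hm'm hm).symm
    _ =ᵐ[μ] μ[μ⟦s | m'⟧ * t.indicator (fun _ => (1 : ℝ)) | m'] := condExp_congr_ae h1
    _ =ᵐ[μ] μ⟦s | m'⟧ * μ⟦t | m'⟧ :=
        condExp_mul_of_stronglyMeasurable_left stronglyMeasurable_condExp hint' (hint ht₀)

end

/-- An injection of `ℕ` with range `{k | n ≤ k}` that fixes every `k` with `n ≤ k < n + m`. -/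
def skipInitial (n m k : ℕ) : ℕ :=
  if k < n then n + m + k else if k < n + m then k else k + n

lemma skipInitial_injective (n m : ℕ) : Function.Injective (skipInitial n m) := by
  intro a b h
  simp only [skipInitial] at h
  split_ifs at h <;> omega

lemma skipInitial_add_of_lt {n m k : ℕ} (hk : k < m) : skipInitial n m (n + k) = n + k := by
  simp only [skipInitial]
  split_ifs <;> omega

lemma le_skipInitial (n m k : ℕ) : n ≤ skipInitial n m k := by
  simp only [skipInitial]
  split_ifs <;> omega

lemma exists_skipInitial_eq (n m k : ℕ) : ∃ j, skipInitial n m j = n + k := by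
  simp only [skipInitial]
  by_cases h1 : k < m
  · exact ⟨n + k, by split_ifs <;> omega⟩
  by_cases h2 : k < m + n
  · exact ⟨k - m, by split_ifs <;> omega⟩
  · exact ⟨k, by split_ifs <;> omega⟩

/-- The second components of the `m` coordinates starting at `n`. -/
def yBlock (X Y : Type*) (n m : ℕ) (x : ℕ → X × Y) : Fin m → Y := fun k => (x (n + k)).2

lemma monotone_comap_yBlock {X Y : Type*} [MeasurableSpace Y] (n : ℕ) :
    Monotone fun m => MeasurableSpace.comap (yBlock X Y n m) MeasurableSpace.pi := by
  intro m m' h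
  simp only [MeasurableSpace.pi, MeasurableSpace.comap_iSup, MeasurableSpace.comap_comp]
  exact iSup_le fun k => le_iSup_of_le (Fin.castLE h k) le_rfl

lemma yBlock_comp_skipInitial {X Y : Type*} (n m : ℕ) (x : ℕ → X × Y) :
    yBlock X Y n m (x ∘ skipInitial n m) = yBlock X Y n m x := by
  ext k
  simp [yBlock, skipInitial_add_of_lt k.2]

section

variable {X Y : Type*} [MeasurableSpace X] [MeasurableSpace Y]

lemma xTail_zero : xTail X Y 0
    = ⨆ k : ℕ, MeasurableSpace.comap (fun x : ℕ → X × Y => (x k).1) inferInstance := by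
  simp only [xTail, Nat.zero_add]

lemma xTail_le_xTail_zero (n : ℕ) : xTail X Y n ≤ xTail X Y 0 := by
  rw [xTail_zero]
  exact iSup_le fun k =>
    le_iSup (fun k => MeasurableSpace.comap (fun x : ℕ → X × Y => (x k).1) inferInstance) (n + k)

lemma xHead_le_xTail_zero (n : ℕ) : xHead X Y n ≤ xTail X Y 0 := by
  rw [xTail_zero]
  exact iSup_le fun i =>
    le_iSup (fun k => MeasurableSpace.comap (fun x : ℕ → X × Y => (x k).1) inferInstance) (i : ℕ)

lemma comap_comp_skipInitial_xTail_zero (n m : ℕ) :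
    (xTail X Y 0).comap (fun x => x ∘ skipInitial n m) = xTail X Y n := by
  rw [xTail_zero, MeasurableSpace.comap_iSup, xTail]
  simp only [MeasurableSpace.comap_comp]
  refine le_antisymm (iSup_le fun k => ?_) (iSup_le fun k => ?_)
  · obtain ⟨j, hj⟩ := Nat.exists_eq_add_of_le (le_skipInitial n m k)
    refine le_iSup_of_le j (le_of_eq ?_)
    rw [← hj]
    rfl
  · obtain ⟨j, hj⟩ := exists_skipInitial_eq n m k
    refine le_iSup_of_le j (le_of_eq ?_)
    rw [← hj]
    rfl

lemma measurable_yBlock (n m : ℕ) : Measurable (yBlock X Y n m) :=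
  measurable_pi_lambda _ fun k => measurable_snd.comp (measurable_pi_apply (n + k))

lemma yTail_eq_iSup_comap_yBlock (n : ℕ) :
    yTail X Y n = ⨆ m, MeasurableSpace.comap (yBlock X Y n m) MeasurableSpace.pi := by
  simp only [MeasurableSpace.pi, MeasurableSpace.comap_iSup, MeasurableSpace.comap_comp]
  refine le_antisymm (iSup_le fun k => ?_) (iSup_le fun m => iSup_le fun k => ?_)
  · exact le_iSup_of_le (k + 1) (le_iSup_of_le (Fin.last k) le_rfl)
  · exact le_iSup_of_le (k : ℕ) le_rfl

end

/-- **Shift covariance, conditional independence form**: for every exchangeable probability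
measure `q` on `ℕ → X × Y` (`X`, `Y` standard Borel) and every `n`, the σ-algebra generated
by the coordinates `(y k)_{k ≥ n}` and the σ-algebra generated by the coordinates
`(x i)_{i < n}` are conditionally independent given the σ-algebra generated by the
coordinates `(x k)_{k ≥ n}`. -/
theorem shift_covariance_condIndep
    {X Y : Type*} [MeasurableSpace X] [MeasurableSpace Y]
    [StandardBorelSpace X] [StandardBorelSpace Y]
    (q : Measure (ℕ → X × Y)) [IsProbabilityMeasure q] (hq : Exchangeable q) (n : ℕ) :
    CondIndep (xTail X Y n) (yTail X Y n) (xHead X Y n) (xTail_le n) q := by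
  rw [yTail_eq_iSup_comap_yBlock]
  refine condIndep_iSup_of_monotone (fun m => ?_) (fun m => (measurable_yBlock n m).comap_le)
    ((xHead_le_xTail_zero n).trans (xTail_le 0)) (monotone_comap_yBlock n)
  refine condIndep_of_condExp_ae_eq (xTail_le n) (xTail_le_xTail_zero n) (xHead_le_xTail_zero n)
    (xTail_le 0) (measurable_yBlock n m).comap_le ?_
  rintro _ ⟨s, hs, rfl⟩
  rw [← comap_comp_skipInitial_xTail_zero n m]
  refine condExp_comap_ae_eq (hq.measurePreserving_comp (skipInitial_injective n m)) (xTail_le 0)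
    ((comap_comp_skipInitial_xTail_zero n m).trans_le (xTail_le_xTail_zero n))
    ((memLp_const 1).indicator (measurable_yBlock n m hs)) ?_
  ext x
  have hmem : x ∘ skipInitial n m ∈ yBlock X Y n m ⁻¹' s ↔ x ∈ yBlock X Y n m ⁻¹' s := by
    rw [Set.mem_preimage, yBlock_comp_skipInitial, Set.mem_preimage]
  by_cases hx : x ∈ yBlock X Y n m ⁻¹' s
  · rw [Function.comp_apply, Set.indicator_of_mem (hmem.2 hx), Set.indicator_of_mem hx]
  · rw [Function.comp_apply, Set.indicator_of_notMem (mt hmem.1 hx), Set.indicator_of_notMem hx]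
end

section
/- De Finetti Theorem (parametric weak form): let W and X be standard Borel spaces and let p : W → (ℕ → X) be an exchangeable Markov kernel. Then there exist a standard Borel space A and Markov kernels q : W → A and f : A → X such that for every w ∈ W, p(w) equals the bind of q(w) with the map a ↦ (f a)^{⊗ℕ}, the countable product measure on ℕ → X with all factors equal to f a. -/
open MeasureTheory ProbabilityTheory

/-- `ν` is the product of the probability measures `μ i` over the (possibly infinite) index
set `ι`: every finite-dimensional cylinder set has the product measure. (For probability
measures this characterizes the countable product measure uniquely.) -/
def IsProductMeasure {ι : Type*} {α : ι → Type*} [∀ i, MeasurableSpace (α i)]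
    (μ : ∀ i, Measure (α i)) (ν : Measure (∀ i, α i)) : Prop :=
  ∀ (s : Finset ι) (t : ∀ i, Set (α i)), (∀ i, MeasurableSet (t i)) →
    ν {x | ∀ i ∈ s, x i ∈ t i} = ∏ i ∈ s, μ i (t i)

/-- A Markov kernel `p : W → (ℕ → X)` is exchangeable if for every permutation `σ` of `ℕ`
fixing all but finitely many elements and every `w`, the pushforward of `p w` under
`x ↦ x ∘ σ` equals `p w`. -/
def ExchangeableKernel {W X : Type*} [MeasurableSpace W] [MeasurableSpace X]
    (p : Kernel W (ℕ → X)) : Prop :=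
  ∀ σ : Equiv.Perm ℕ, {n | σ n ≠ n}.Finite → ∀ w, (p w).map (fun x => x ∘ σ) = p w

/-- The kernel `p : W → (ℕ → X)` is, parametrically in `w`, a mixture of iid measures with
standard Borel mixing space `A`: there are Markov kernels `q : W → A` and `f : A → X` such
that `p w = ∫_A (f a)^{⊗ℕ} d(q w)(a)` for every `w`, where `(f a)^{⊗ℕ}` is the countable
product with all factors equal to `f a`. -/
def IsParametricDeFinettiMixture {W X : Type*} [MeasurableSpace W] [MeasurableSpace X]
    (p : Kernel W (ℕ → X)) (A : Type) [MeasurableSpace A] : Prop :=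
  StandardBorelSpace A ∧
    ∃ (q : Kernel W A) (f : Kernel A X), IsMarkovKernel q ∧ IsMarkovKernel f ∧
      ∃ P : A → Measure (ℕ → X), Measurable P ∧
        (∀ a, IsProductMeasure (fun _ : ℕ => f a) (P a)) ∧
        ∀ w, p w = (q w).bind P

open scoped ENNReal

namespace DeFinetti

/-- The left shift of a sequence. -/
def shift {X : Type*} (x : ℕ → X) : ℕ → X := fun i => x (i + 1)

/-- The increasing map `ℕ → ℕ` whose range omits exactly `m`. -/
def skip (m i : ℕ) : ℕ := if i < m then i else i + 1

/-- The cycle `m ↦ m + 1 ↦ ⋯ ↦ m + n ↦ m`. It agrees with `skip m` on `[0, m + n)`. -/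
def skipPerm (m n : ℕ) : Equiv.Perm ℕ where
  toFun i := if m ≤ i ∧ i < m + n then i + 1 else if i = m + n then m else i
  invFun i := if m < i ∧ i ≤ m + n then i - 1 else if i = m then m + n else i
  left_inv i := by grind
  right_inv i := by grind

section Measurability

variable {X : Type*} [MeasurableSpace X]

@[fun_prop]
lemma measurable_shift : Measurable (shift : (ℕ → X) → ℕ → X) :=
  measurable_pi_lambda _ fun i => measurable_pi_apply (i + 1)

lemma measurable_comp_right (k : ℕ → ℕ) : Measurable fun x : ℕ → X => x ∘ k :=
  measurable_pi_lambda _ fun i => measurable_pi_apply (k i)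

/-- Finite measures on a product space agree if they agree on square cylinders. -/
lemma measure_ext_of_pi {ι : Type*} {α : ι → Type*} [∀ i, MeasurableSpace (α i)]
    {μ ν : Measure (∀ i, α i)} [IsFiniteMeasure μ]
    (h : ∀ (s : Finset ι) (t : ∀ i, Set (α i)), (∀ i, MeasurableSet (t i)) →
      μ (Set.pi s t) = ν (Set.pi s t)) : μ = ν := by
  refine ext_of_generate_finite _ generateFrom_squareCylinders.symm
    (isPiSystem_squareCylinders (fun _ => MeasurableSpace.isPiSystem_measurableSet) (by simp))
    ?_ ?_
  · rintro _ ⟨s, t, ht, rfl⟩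
    exact h s t fun i => ht i (Set.mem_univ i)
  · simpa using h ∅ (fun _ => Set.univ) fun _ => MeasurableSet.univ

lemma measurable_infinitePi {Z ι : Type*} [MeasurableSpace Z] (κ : Kernel Z X)
    [IsMarkovKernel κ] :
    Measurable fun z => Measure.infinitePi fun _ : ι => κ z := by
  refine Measurable.measure_of_isPiSystem_of_isProbabilityMeasure
    generateFrom_squareCylinders.symm
    (isPiSystem_squareCylinders (fun _ => MeasurableSpace.isPiSystem_measurableSet) (by simp)) ?_
  rintro _ ⟨s, t, ht, rfl⟩
  have ht' : ∀ i, MeasurableSet (t i) := fun i => ht i (Set.mem_univ i)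
  simp_rw [Measure.infinitePi_pi _ fun i _ => ht' i]
  exact Finset.measurable_fun_prod s fun i _ => κ.measurable_coe (ht' i)

/-- An exchangeable law is invariant under omitting one coordinate. -/
lemma map_comp_skip {μ : Measure (ℕ → X)} [IsProbabilityMeasure μ]
    (hμ : ∀ σ : Equiv.Perm ℕ, {n | σ n ≠ n}.Finite → μ.map (fun x => x ∘ σ) = μ) (m : ℕ) :
    μ.map (fun x => x ∘ skip m) = μ := by
  have : IsProbabilityMeasure (μ.map (fun x => x ∘ skip m)) :=
    Measure.isProbabilityMeasure_map (measurable_comp_right _).aemeasurable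
  refine measure_ext_of_pi fun s t ht => ?_
  have hst : MeasurableSet (Set.pi (s : Set ℕ) t) :=
    MeasurableSet.pi s.countable_toSet fun i _ => ht i
  obtain ⟨n, hn⟩ := s.exists_nat_subset_range
  have hfin : {i | skipPerm m n i ≠ i}.Finite := by
    refine (Set.finite_Iic (m + n)).subset fun i hi => ?_
    simp only [skipPerm, Equiv.coe_fn_mk, Set.mem_ofPred_eq, Set.mem_Iic] at hi ⊢
    grind
  conv_rhs => rw [← hμ _ hfin]
  rw [Measure.map_apply (measurable_comp_right _) hst,
    Measure.map_apply (measurable_comp_right _) hst]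
  congr 1
  ext x
  have key : ∀ i ∈ s, skipPerm m n i = skip m i := by
    intro i hi
    have := Finset.mem_range.1 (hn hi)
    simp only [skipPerm, skip, Equiv.coe_fn_mk]
    grind
  simp only [Set.mem_preimage, Set.mem_pi, Finset.mem_coe, Function.comp_apply]
  exact forall₂_congr fun i hi => by rw [key i hi]

end Measurability

/-- Two functions with `∫ u² = ∫ u v = ∫ v² < ∞` agree almost everywhere. -/
lemma ae_eq_of_lintegral_mul_eq {Ω : Type*} [MeasurableSpace Ω] {μ : Measure Ω}
    {u v : Ω → ℝ≥0∞} (hu : Measurable u) (hv : Measurable v)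
    (hu_top : ∀ x, u x ≠ ∞) (hv_top : ∀ x, v x ≠ ∞)
    (huu_top : ∫⁻ x, u x * u x ∂μ ≠ ∞)
    (huv : ∫⁻ x, u x * v x ∂μ = ∫⁻ x, u x * u x ∂μ)
    (hvv : ∫⁻ x, v x * v x ∂μ = ∫⁻ x, u x * u x ∂μ) : u =ᵐ[μ] v := by
  have hpt : ∀ x, u x * u x + v x * v x =
      (u x * v x + u x * v x) + ((u x - v x) + (v x - u x)) ^ 2 := by
    intro x
    lift u x to NNReal using hu_top x with a
    lift v x to NNReal using hv_top x with b
    norm_cast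
    rcases le_total a b with hab | hab
    · obtain ⟨d, rfl⟩ := exists_add_of_le hab
      simp only [tsub_eq_zero_of_le hab, add_tsub_cancel_left]
      ring
    · obtain ⟨d, rfl⟩ := exists_add_of_le hab
      simp only [tsub_eq_zero_of_le hab, add_tsub_cancel_left]
      ring
  have hint := lintegral_congr (μ := μ) hpt
  rw [lintegral_add_left (by fun_prop), lintegral_add_left (by fun_prop),
    lintegral_add_left (by fun_prop), huv, hvv] at hint
  have hzero : ∫⁻ x, ((u x - v x) + (v x - u x)) ^ 2 ∂μ = 0 := by
    have h2 : (∫⁻ x, u x * u x ∂μ) + (∫⁻ x, u x * u x ∂μ) ≠ ∞ := by simp [huu_top]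
    refine (ENNReal.add_right_inj h2).1 ?_
    rw [add_zero]
    exact hint.symm
  rw [lintegral_eq_zero_iff (by fun_prop)] at hzero
  filter_upwards [hzero] with x hx
  simp only [Pi.zero_apply, ne_eq, OfNat.ofNat_ne_zero, not_false_eq_true, pow_eq_zero_iff,
    add_eq_zero, tsub_eq_zero_iff_le] at hx
  exact le_antisymm hx.1 hx.2

section Directing

variable {X : Type*} [MeasurableSpace X] {μ : Measure (ℕ → X)} [IsProbabilityMeasure μ]
  {κ : Kernel (ℕ → X) X} [IsMarkovKernel κ]

/-- The conditional law of the first coordinate given the later ones is shift-invariant. -/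
lemma condLaw_shift_ae_eq
    (h₀ : μ.map (fun x => x ∘ skip 0) = μ) (h₁ : μ.map (fun x => x ∘ skip 1) = μ)
    (hκ : ∀ B, MeasurableSet B → ∀ g : (ℕ → X) → ℝ≥0∞, Measurable g →
      ∫⁻ x, B.indicator 1 (x 0) * g (shift x) ∂μ = ∫⁻ x, κ x B * g x ∂μ)
    {B : Set X} (hB : MeasurableSet B) :
    (fun x => κ (shift x) B) =ᵐ[μ] fun x => κ x B := by
  have hu : Measurable fun x => κ x B := κ.measurable_coe hB
  have hv : Measurable fun x => κ (shift x) B := hu.comp measurable_shift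
  have hind : Measurable fun x : ℕ → X => B.indicator (1 : X → ℝ≥0∞) (x 0) :=
    (measurable_one.indicator hB).comp (measurable_pi_apply 0)
  refine (ae_eq_of_lintegral_mul_eq hu hv (fun _ => measure_ne_top _ _)
    (fun _ => measure_ne_top _ _) ?_ ?_ ?_).symm
  · refine ne_top_of_le_ne_top ENNReal.one_ne_top ?_
    calc ∫⁻ x, κ x B * κ x B ∂μ ≤ ∫⁻ _, 1 ∂μ :=
          lintegral_mono fun x => mul_le_one' prob_le_one prob_le_one
      _ = 1 := by simp
  · rw [← hκ B hB _ hv, ← hκ B hB _ hu]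
    conv_rhs => rw [← h₁]
    exact (lintegral_map (hind.mul hv) (measurable_comp_right (skip 1))).symm
  · conv_rhs => rw [← h₀]
    exact (lintegral_map (hu.mul hu) (measurable_comp_right _)).symm

/-- Conditionally on the shift-invariant information, the coordinates are iid with law `κ`. -/
lemma lintegral_prod_indicator
    (h₀ : μ.map (fun x => x ∘ skip 0) = μ) (h₁ : μ.map (fun x => x ∘ skip 1) = μ)
    (hκ : ∀ B, MeasurableSet B → ∀ g : (ℕ → X) → ℝ≥0∞, Measurable g →
      ∫⁻ x, B.indicator 1 (x 0) * g (shift x) ∂μ = ∫⁻ x, κ x B * g x ∂μ)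
    (n : ℕ) (B : ℕ → Set X) (hB : ∀ i, MeasurableSet (B i))
    (g : (ℕ → X) → ℝ≥0∞) (hg : Measurable g) (hgs : (fun x => g (shift x)) =ᵐ[μ] g) :
    ∫⁻ x, (∏ i ∈ Finset.range n, (B i).indicator 1 (x i)) * g x ∂μ =
      ∫⁻ x, (∏ i ∈ Finset.range n, κ x (B i)) * g x ∂μ := by
  induction n generalizing B g with
  | zero => simp
  | succ n ih =>
    have hu : Measurable fun x => κ x (B 0) := κ.measurable_coe (hB 0)
    have hprod : Measurable fun x : ℕ → X =>
        ∏ i ∈ Finset.range n, (B (i + 1)).indicator (1 : X → ℝ≥0∞) (x i) :=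
      Finset.measurable_fun_prod _ fun i _ =>
        (measurable_one.indicator (hB (i + 1))).comp (measurable_pi_apply i)
    calc ∫⁻ x, (∏ i ∈ Finset.range (n + 1), (B i).indicator 1 (x i)) * g x ∂μ
        = ∫⁻ x, (B 0).indicator 1 (x 0) *
            ((∏ i ∈ Finset.range n, (B (i + 1)).indicator 1 (shift x i)) * g (shift x)) ∂μ := by
          refine lintegral_congr_ae ?_
          filter_upwards [hgs] with x hx
          rw [hx, Finset.prod_range_succ']
          simp only [shift]
          ring
      _ = ∫⁻ x, κ x (B 0) *
            ((∏ i ∈ Finset.range n, (B (i + 1)).indicator 1 (x i)) * g x) ∂μ :=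
          hκ _ (hB 0) _ (hprod.mul hg)
      _ = ∫⁻ x, (∏ i ∈ Finset.range n, (B (i + 1)).indicator 1 (x i)) *
            (κ x (B 0) * g x) ∂μ := lintegral_congr fun x => by ring
      _ = ∫⁻ x, (∏ i ∈ Finset.range n, κ x (B (i + 1))) * (κ x (B 0) * g x) ∂μ := by
          refine ih (fun i => B (i + 1)) (fun i => hB (i + 1)) (fun x => κ x (B 0) * g x)
            (hu.mul hg) ?_
          filter_upwards [hgs, condLaw_shift_ae_eq h₀ h₁ hκ (hB 0)] with x hx hx'
          rw [hx, hx']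
      _ = ∫⁻ x, (∏ i ∈ Finset.range (n + 1), κ x (B i)) * g x ∂μ :=
          lintegral_congr fun x => by rw [Finset.prod_range_succ']; ring

/-- An exchangeable law is the mixture of the powers of the conditional law of the first
coordinate given the later ones. -/
lemma eq_bind_infinitePi
    (h₀ : μ.map (fun x => x ∘ skip 0) = μ) (h₁ : μ.map (fun x => x ∘ skip 1) = μ)
    (hκ : ∀ B, MeasurableSet B → ∀ g : (ℕ → X) → ℝ≥0∞, Measurable g →
      ∫⁻ x, B.indicator 1 (x 0) * g (shift x) ∂μ = ∫⁻ x, κ x B * g x ∂μ) :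
    μ = μ.bind fun x => Measure.infinitePi fun _ : ℕ => κ x := by
  classical
  refine measure_ext_of_pi fun s t ht => ?_
  have hst : MeasurableSet (Set.pi (s : Set ℕ) t) :=
    MeasurableSet.pi s.countable_toSet fun i _ => ht i
  rw [Measure.bind_apply hst (measurable_infinitePi κ).aemeasurable]
  simp_rw [Measure.infinitePi_pi _ fun i _ => ht i]
  obtain ⟨n, hn⟩ := s.exists_nat_subset_range
  have key := lintegral_prod_indicator h₀ h₁ hκ n (fun i => if i ∈ s then t i else Set.univ)
    (fun i => by split_ifs <;> simp [ht]) 1 measurable_one (.of_forall fun _ => rfl)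
  simp only [Pi.one_apply, mul_one] at key
  have hL : ∀ x : ℕ → X, ∏ i ∈ Finset.range n,
      (if i ∈ s then t i else Set.univ).indicator (1 : X → ℝ≥0∞) (x i) =
      (Set.pi (s : Set ℕ) t).indicator 1 x := by
    intro x
    rw [← Finset.prod_subset hn fun i _ hi => by simp [hi]]
    by_cases hx : x ∈ Set.pi (s : Set ℕ) t
    · rw [Set.indicator_of_mem hx]
      exact Finset.prod_eq_one fun i hi => by simp [hi, hx i hi]
    · rw [Set.indicator_of_notMem hx]
      simp only [Set.mem_pi, not_forall, Finset.mem_coe] at hx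
      obtain ⟨i, hi, hxi⟩ := hx
      exact Finset.prod_eq_zero hi (by simp [hi, hxi])
  have hR : ∀ x : ℕ → X, ∏ i ∈ Finset.range n, κ x (if i ∈ s then t i else Set.univ) =
      ∏ i ∈ s, κ x (t i) := by
    intro x
    rw [← Finset.prod_subset hn fun i _ hi => by simp [hi]]
    exact Finset.prod_congr rfl fun i hi => by simp [hi]
  simp_rw [hL, hR] at key
  rw [← key, lintegral_indicator_one hst]

end Directing

section Transfer

variable {W X : Type*} [MeasurableSpace W] [MeasurableSpace X]

/-- A mixture of iid laws over an arbitrary standard Borel space can be reindexed by a standard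
Borel space in `Type`. -/
lemma exists_mixture_of_eq_bind {Z : Type*} [MeasurableSpace Z] [StandardBorelSpace Z]
    {p : Kernel W (ℕ → X)} (q : Kernel W Z) (f : Kernel Z X) [IsMarkovKernel q]
    [IsMarkovKernel f]
    (h : ∀ w, p w = (q w).bind fun z => Measure.infinitePi fun _ : ℕ => f z) :
    ∃ (A : Type) (mA : MeasurableSpace A), @IsParametricDeFinettiMixture W X _ _ p A mA := by
  have he := measurableEmbedding_embeddingReal Z
  let e : Z ≃ᵐ Set.range (embeddingReal Z) := he.equivRange
  have hf : IsMarkovKernel (f.comap e.symm e.symm.measurable) := inferInstance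
  refine ⟨Set.range (embeddingReal Z), inferInstance, he.measurableSet_range.standardBorel,
    q.map e, f.comap e.symm e.symm.measurable, Kernel.IsMarkovKernel.map q e.measurable, hf,
    fun a => Measure.infinitePi fun _ : ℕ => f.comap e.symm e.symm.measurable a,
    measurable_infinitePi _, fun a s t ht => ?_, fun w => ?_⟩
  · exact Measure.infinitePi_pi _ fun i _ => ht i
  · rw [h w]
    ext s hs
    rw [Measure.bind_apply hs (measurable_infinitePi f).aemeasurable,
      Measure.bind_apply hs (measurable_infinitePi _).aemeasurable,
      Kernel.map_apply _ e.measurable]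
    refine Eq.trans ?_
      (lintegral_map ((Measure.measurable_coe hs).comp (measurable_infinitePi _)) e.measurable).symm
    simp [Kernel.comap_apply]

end Transfer

end DeFinetti

open DeFinetti

/-- **De Finetti Theorem (parametric weak form)**: every exchangeable Markov kernel
`p : W → (ℕ → X)` between standard Borel spaces is, parametrically in `w ∈ W`, a mixture of
iid measures. -/
theorem deFinetti_parametric_weak
    {W X : Type*} [MeasurableSpace W] [MeasurableSpace X]
    [StandardBorelSpace W] [StandardBorelSpace X]
    (p : Kernel W (ℕ → X)) [IsMarkovKernel p] (hp : ExchangeableKernel p) :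
    ∃ (A : Type) (mA : MeasurableSpace A), @IsParametricDeFinettiMixture W X _ _ p A mA := by
  rcases isEmpty_or_nonempty X with hX | hX
  · have hW : IsEmpty W := ⟨fun w => (p w).nonempty_of_neZero.elim fun x => hX.elim (x 0)⟩
    exact ⟨Empty, inferInstance, inferInstance, 0, 0, ⟨fun w => hW.elim w⟩, ⟨fun a => a.elim⟩,
      fun a => a.elim, measurable_of_empty _, fun a => a.elim, fun w => hW.elim w⟩
  · have hsplit : Measurable fun x : ℕ → X => (shift x, x 0) :=
      measurable_shift.prodMk (measurable_pi_apply 0)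
    let r : Kernel W ((ℕ → X) × X) := p.map fun x => (shift x, x 0)
    have hr : IsMarkovKernel r := Kernel.IsMarkovKernel.map p hsplit
    have hskip : ∀ m w, (p w).map (fun x => x ∘ skip m) = p w := fun m w =>
      map_comp_skip (fun σ hσ => hp σ hσ w) m
    have hfst : ∀ w, r.fst w = p w := by
      intro w
      rw [Kernel.fst_apply, Kernel.map_apply _ hsplit, Measure.map_map measurable_fst hsplit]
      exact hskip 0 w
    refine exists_mixture_of_eq_bind (Kernel.id ×ₖ p) r.condKernel fun w => ?_
    have hκ : ∀ B, MeasurableSet B → ∀ g : (ℕ → X) → ℝ≥0∞, Measurable g →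
        ∫⁻ x, B.indicator 1 (x 0) * g (shift x) ∂(p w) =
          ∫⁻ x, r.condKernel.sectR w x B * g x ∂(p w) := by
      intro B hB g hg
      have hF : Measurable fun y : (ℕ → X) × X => B.indicator (1 : X → ℝ≥0∞) y.2 * g y.1 :=
        ((measurable_one.indicator hB).comp measurable_snd).mul (hg.comp measurable_fst)
      calc ∫⁻ x, B.indicator 1 (x 0) * g (shift x) ∂(p w)
          = ∫⁻ y, B.indicator 1 y.2 * g y.1 ∂(r w) := by
            rw [Kernel.map_apply _ hsplit, lintegral_map hF hsplit]
        _ = ∫⁻ y, B.indicator 1 y.2 * g y.1 ∂((r.fst ⊗ₖ r.condKernel) w) := by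
            rw [r.disintegrate r.condKernel]
        _ = ∫⁻ x, r.condKernel.sectR w x B * g x ∂(p w) := by
            rw [Kernel.lintegral_compProd _ _ _ hF, hfst]
            refine lintegral_congr fun x => ?_
            dsimp only
            rw [lintegral_mul_const _ (measurable_one.indicator hB), lintegral_indicator_one hB,
              Kernel.sectR_apply]
    conv_lhs => rw [eq_bind_infinitePi (hskip 0 w) (hskip 1 w) hκ]
    ext s hs
    rw [Measure.bind_apply hs (measurable_infinitePi _).aemeasurable,
      Measure.bind_apply hs (measurable_infinitePi _).aemeasurable, Kernel.prod_apply,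
      Kernel.id_apply, Measure.dirac_prod]
    refine Eq.trans ?_
      (lintegral_map ((Measure.measurable_coe hs).comp (measurable_infinitePi _))
        measurable_prodMk_left).symm
    simp [Kernel.sectR_apply]
end
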